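/- Suppose the stationary measure ℙ satisfies conditions ID, FE and SE (with constants γ_+ < 0 and γ_- < 0). Fix ε ∈ (0,1/2), 0 < α < γ_+/(8γ_-), y ∈ supp ℙ, and consider the block auxiliary parsing of y_1^N; suppose the s-th block of y_1^N is good. Then, with ℓ_- := ln N/(−2γ_-), ℓ_+ := 2 ln N/(−γ_+) and d_+ := 2N^α/ℓ_-, for all N large enough, ℙ{x : #{j : y^{(j,s,N)} appears as a substring of x_1^N} > ε d_+} ≤ ℓ_+² · exp(γ_+ ε² d_+ / (8 ℓ_+)). -/

import Mathlib

open MeasureTheory Filter Asymptotics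
open scoped ENNReal Classical

noncomputable section

namespace ZM

/-- The left shift on one-sided sequences. -/
def shift {A : Type*} (x : ℕ → A) : ℕ → A := fun k => x (k + 1)

/-- The cylinder set of all sequences starting with the word `a`. -/
def cyl {A : Type*} {n : ℕ} (a : Fin n → A) : Set (ℕ → A) := {x | ∀ i : Fin n, x i = a i}

/-- The word `x_{p+1}^{p+ℓ}` of `x` (0-based: the letters at positions `p, …, p+ℓ-1`). -/
def seg {A : Type*} (y : ℕ → A) (p ℓ : ℕ) : Fin ℓ → A := fun i => y (p + i)

/-- `w` occurs in `x` at (0-based) offset `r`. -/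
def matchAt {A : Type*} (x : ℕ → A) {ℓ : ℕ} (w : Fin ℓ → A) (r : ℕ) : Prop :=
  ∀ i : Fin ℓ, x (r + i) = w i

/-- `w` appears as a substring of `x_1^N`. -/
def appears {A : Type*} (N : ℕ) (x : ℕ → A) {ℓ : ℕ} (w : Fin ℓ → A) : Prop :=
  ∃ r, r + ℓ ≤ N ∧ matchAt x w r

/-- The waiting time `W_ℓ(w, x)`: the least (1-based) position at which `w` occurs in `x`,
`⊤` if `w` never occurs. -/
def W {A : Type*} {ℓ : ℕ} (w : Fin ℓ → A) (x : ℕ → A) : ℕ∞ :=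
  sInf {r : ℕ∞ | ∃ n : ℕ, r = (n : ℕ∞) ∧ 1 ≤ n ∧ matchAt x w (n - 1)}

section ZMparsing

variable {A : Type*}

/-- Length of the Ziv–Merhav word starting at (0-based) position `p` of `y_1^N`, with
database `x_1^N`: the longest prefix of the remaining portion of `y_1^N` appearing as a
substring of `x_1^N`, or a single letter if there is no such prefix. -/
def zmLen (N : ℕ) (x y : ℕ → A) (p : ℕ) : ℕ :=
  max 1 (sSup {ℓ | p + ℓ ≤ N ∧ appears N x (seg y p ℓ)})

/-- Starting position of the `j`-th (0-based) word of the Ziv–Merhav parsing. -/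
def zmPos (N : ℕ) (x y : ℕ → A) : ℕ → ℕ
  | 0 => 0
  | j + 1 => zmPos N x y j + zmLen N x y (zmPos N x y j)

/-- `c_N(y|x)`: the number of words in the Ziv–Merhav parsing of `y_1^N` w.r.t. `x_1^N`. -/
def cN (N : ℕ) (x y : ℕ → A) : ℕ := sInf {c | N ≤ zmPos N x y c}

/-- The Ziv–Merhav estimator `Q̂_N(y, x) = c_N(y|x) ln N / N`. -/
def ZMest (N : ℕ) (x y : ℕ → A) : ℝ := (cN N x y : ℝ) * Real.log N / N

end ZMparsing

section MeasureDefs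

variable {A : Type*} [MeasurableSpace A]

/-- The measure of the cylinder of a word, as a real number. -/
def wp (μ : Measure (ℕ → A)) {n : ℕ} (a : Fin n → A) : ℝ := (μ (cyl a)).toReal

/-- `supp ℙ`: the set of sequences all of whose prefixes have positive measure. -/
def suppSet (μ : Measure (ℕ → A)) : Set (ℕ → A) := {x | ∀ n, 0 < μ (cyl (seg x 0 n))}

/-- Condition (ID): immediate decoupling on the support, with sequence `k`. -/
def CondID (μ : Measure (ℕ → A)) (k : ℕ → ℝ) : Prop :=
  Monotone k ∧ (k =o[atTop] fun n => (n : ℝ)) ∧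
    ∀ (n m : ℕ) (a : Fin n → A) (b : Fin m → A), 0 < μ (cyl a) → 0 < μ (cyl b) →
      wp μ (Fin.append a b) ≤ Real.exp (k n) * (wp μ a * wp μ b) ∧
      (0 < μ (cyl (Fin.append a b)) →
        Real.exp (-k n) * (wp μ a * wp μ b) ≤ wp μ (Fin.append a b))

/-- Condition (FE): fast enough decay, with rate `γp < 0`. -/
def CondFE (μ : Measure (ℕ → A)) (γp : ℝ) : Prop :=
  γp < 0 ∧ ∀ᶠ n : ℕ in atTop, ∀ a : Fin n → A, 0 < μ (cyl a) → wp μ a ≤ Real.exp (γp * n)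

/-- Condition (SE): slow enough decay, with rate `γm < 0`. -/
def CondSE (μ : Measure (ℕ → A)) (γm : ℝ) : Prop :=
  γm < 0 ∧ ∀ᶠ n : ℕ in atTop, ∀ a : Fin n → A, 0 < μ (cyl a) → Real.exp (γm * n) ≤ wp μ a

/-- Condition (KB): Kontoyiannis' bound on waiting times, with sequences `k`, `τ`. -/
def CondKB (μ : Measure (ℕ → A)) (k τ : ℕ → ℝ) : Prop :=
  (k =o[atTop] fun n => (n : ℝ)) ∧ (τ =o[atTop] fun n => (n : ℝ)) ∧
    ∀ (ℓ : ℕ) (a : Fin ℓ → A) (r : ℕ),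
      (μ {x | (r : ℕ∞) ≤ W a x}).toReal ≤
        Real.exp (-(Real.exp (-k ℓ) * wp μ a * (⌊((r : ℝ) - 1) / ((ℓ : ℝ) + τ ℓ)⌋ : ℝ)))

/-- Length of the next word of the auxiliary parsing of `y_1^N` starting at position `p`:
the shortest prefix of the remaining portion of `y_1^N` with measure at most `θ`, or the
whole remaining portion if there is no such prefix. -/
def auxLen (μ : Measure (ℕ → A)) (θ : ℝ) (N : ℕ) (y : ℕ → A) (p : ℕ) : ℕ :=
  if ∃ ℓ, 1 ≤ ℓ ∧ p + ℓ ≤ N ∧ wp μ (seg y p ℓ) ≤ θ then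
    sInf {ℓ | 1 ≤ ℓ ∧ p + ℓ ≤ N ∧ wp μ (seg y p ℓ) ≤ θ}
  else N - p

/-- Starting position of the `j`-th (0-based) word of the auxiliary parsing. -/
def auxPos (μ : Measure (ℕ → A)) (θ : ℝ) (N : ℕ) (y : ℕ → A) : ℕ → ℕ
  | 0 => 0
  | j + 1 => auxPos μ θ N y j + max 1 (auxLen μ θ N y (auxPos μ θ N y j))

/-- Length of the `j`-th (0-based) word of the auxiliary parsing. -/
def auxWordLen (μ : Measure (ℕ → A)) (θ : ℝ) (N : ℕ) (y : ℕ → A) (j : ℕ) : ℕ :=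
  max 1 (auxLen μ θ N y (auxPos μ θ N y j))

/-- The number of words in the auxiliary parsing of `y_1^N`. -/
def auxCount (μ : Measure (ℕ → A)) (θ : ℝ) (N : ℕ) (y : ℕ → A) : ℕ :=
  sInf {c | N ≤ auxPos μ θ N y c}

/-- Length of the next word of the block parsing within a block ending at position `e`:
the shortest prefix of the remaining portion of the block with measure at most `θ`;
`0` encodes that no such prefix exists (the rest of the block is the buffer). -/
def blkLen (μ : Measure (ℕ → A)) (θ : ℝ) (e : ℕ) (y : ℕ → A) (p : ℕ) : ℕ :=
  sInf {ℓ | 1 ≤ ℓ ∧ p + ℓ ≤ e ∧ wp μ (seg y p ℓ) ≤ θ}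

/-- Starting position of the `i`-th (0-based) word of the block starting at `q`, ending at `e`. -/
def blkPos (μ : Measure (ℕ → A)) (θ : ℝ) (e : ℕ) (y : ℕ → A) (q : ℕ) : ℕ → ℕ
  | 0 => q
  | i + 1 => blkPos μ θ e y q i + blkLen μ θ e y (blkPos μ θ e y q i)

/-- Number `d_s` of words in the block starting at `q` and ending at `e`. -/
def dCount (μ : Measure (ℕ → A)) (θ : ℝ) (e : ℕ) (y : ℕ → A) (q : ℕ) : ℕ :=
  sInf {i | blkLen μ θ e y (blkPos μ θ e y q i) = 0}

/-- The block starting at `q` and ending at `e` is good: its parsed words are pairwise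
distinct. -/
def GoodBlock (μ : Measure (ℕ → A)) (θ : ℝ) (e : ℕ) (y : ℕ → A) (q : ℕ) : Prop :=
  ∀ i j : ℕ, i < dCount μ θ e y q → j < dCount μ θ e y q →
    blkLen μ θ e y (blkPos μ θ e y q i) = blkLen μ θ e y (blkPos μ θ e y q j) →
    (∀ t < blkLen μ θ e y (blkPos μ θ e y q i),
      y (blkPos μ θ e y q i + t) = y (blkPos μ θ e y q j + t)) →
    i = j

end MeasureDefs

/-- The block length `⌊N^α⌋`. -/
def blockB (N : ℕ) (α : ℝ) : ℕ := ⌊(N : ℝ) ^ α⌋₊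

/-- The number `M_N` of blocks. -/
def blockM (N : ℕ) (α : ℝ) : ℕ := (N + blockB N α - 1) / blockB N α

/-- The starting position of the `s`-th (0-based) block. -/
def blockStart (N : ℕ) (α : ℝ) (s : ℕ) : ℕ := s * blockB N α

/-- The end position of the `s`-th (0-based) block. -/
def blockEnd (N : ℕ) (α : ℝ) (s : ℕ) : ℕ := min ((s + 1) * blockB N α) N

/-- `S_b(y_1^N)`: the set of bad blocks of the block auxiliary parsing (with threshold
`N^{-1-ε}`, word probabilities computed with `μ`). -/
def badSet {A : Type*} [MeasurableSpace A] (μ : Measure (ℕ → A)) (N : ℕ) (α ε : ℝ)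
    (y : ℕ → A) : Set ℕ :=
  {s | s < blockM N α ∧
    ¬ GoodBlock μ ((N : ℝ) ^ (-1 - ε)) (blockEnd N α s) y (blockStart N α s)}

/-- `ℓ₋ = ln N / (-2 γ₋)`. -/
def ellMinus (N : ℕ) (γm : ℝ) : ℝ := Real.log N / (-2 * γm)

/-- `ℓ₊ = 2 ln N / (-γ₊)`. -/
def ellPlus (N : ℕ) (γp : ℝ) : ℝ := 2 * Real.log N / (-γp)

/-- `d₊ = 2 N^α / ℓ₋`. -/
def dPlus (N : ℕ) (α γm : ℝ) : ℝ := 2 * (N : ℝ) ^ α / ellMinus N γm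

section CrossEntropy

variable {A : Type*} [MeasurableSpace A] [Fintype A]

/-- The `n`-th cross-entropy average `-(1/n) ∑_{a ∈ 𝒜ⁿ} ℚ[a] ln ℙ[a]`, real-valued version. -/
def hcSeq (μP μQ : Measure (ℕ → A)) (n : ℕ) : ℝ :=
  -(1 / (n : ℝ)) * ∑ a : Fin n → A, wp μQ a * Real.log (wp μP a)

/-- `-ln p` as an element of `[0, ∞]`, for `p ∈ [0, 1]`; equals `⊤` when `p = 0`. -/
def negLog (p : ℝ≥0∞) : ℝ≥0∞ := if p = 0 then ⊤ else ENNReal.ofReal (-Real.log p.toReal)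

/-- The `n`-th cross-entropy average, `[0, ∞]`-valued version. -/
def hcSeqE (μP μQ : Measure (ℕ → A)) (n : ℕ) : ℝ≥0∞ :=
  (∑ a : Fin n → A, μQ (cyl a) * negLog (μP (cyl a))) / (n : ℝ≥0∞)

end CrossEntropy

end ZM

namespace ZM

/-- A finite measurable space carries a map selecting one letter in each atom. -/
lemma exists_atom_section (A : Type*) [Finite A] [MeasurableSpace A] :
    ∃ π : A → A, (∀ a, π (π a) = π a) ∧ (∀ b, MeasurableSet (π ⁻¹' {b})) ∧
      ∀ a b, π a = π b → ∀ s, MeasurableSet s → a ∈ s → b ∈ s := by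
  let r : Setoid A :=
    { r := fun a b => ∀ s, MeasurableSet s → (a ∈ s ↔ b ∈ s)
      iseqv := ⟨fun _ _ _ => Iff.rfl, fun h s hs => (h s hs).symm,
        fun h h' s hs => (h s hs).trans (h' s hs)⟩ }
  have hr : ∀ a b : A, r a b ↔ ∀ s, MeasurableSet s → (a ∈ s ↔ b ∈ s) := fun _ _ => Iff.rfl
  have hπ : ∀ a : A, r (Quotient.out (Quotient.mk r a)) a := fun a => Quotient.mk_out a
  refine ⟨fun a => Quotient.out (Quotient.mk r a), fun a => ?_, fun b => ?_,
    fun a b h s hs ha => ?_⟩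
  · exact congrArg Quotient.out (Quotient.out_eq _)
  · by_cases hb : Quotient.out (Quotient.mk r b) = b
    · have : (fun a => Quotient.out (Quotient.mk r a)) ⁻¹' {b} = measurableAtom b := by
        ext a
        simp only [Set.mem_preimage, Set.mem_singleton_iff, measurableAtom, Set.mem_iInter]
        constructor
        · intro h s hbs hs
          have := (hr _ _).1 (hπ a) s hs
          rw [h] at this
          exact this.1 hbs
        · intro h
          rw [← hb]
          refine congrArg Quotient.out (Quotient.sound ((hr _ _).2 fun s hs =>
            ⟨fun ha => ?_, fun h' => h s h' hs⟩))
          by_contra hbs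
          exact h sᶜ hbs hs.compl ha
      rw [this]
      exact MeasurableSet.measurableAtom_of_countable b
    · have : (fun a => Quotient.out (Quotient.mk r a)) ⁻¹' {b} = ∅ := by
        ext a
        simp only [Set.mem_preimage, Set.mem_singleton_iff, Set.mem_empty_iff_false, iff_false]
        rintro rfl
        exact hb (congrArg Quotient.out (Quotient.out_eq _))
      rw [this]
      exact MeasurableSet.empty
  · have h1 := (hr _ _).1 (hπ a) s hs
    have h2 := (hr _ _).1 (hπ b) s hs
    simp only at h
    rw [h] at h1
    exact h2.1 (h1.2 ha)

lemma shift_iterate {A : Type*} (x : ℕ → A) (r i : ℕ) : (shift^[r] x) i = x (r + i) := by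
  induction r generalizing x with
  | zero => simp
  | succ r ih => rw [Function.iterate_succ_apply, ih, shift]; congr 1; omega

section Decoupling

variable {A : Type*} [MeasurableSpace A] {μ : Measure (ℕ → A)} {π : A → A}

/-- Measurable sets of sequences do not separate letters of the same atom. -/
lemma mem_of_atom_eq (hπ : ∀ a b, π a = π b → ∀ s, MeasurableSet s → a ∈ s → b ∈ s)
    {S : Set (ℕ → A)} (hS : MeasurableSet S) {x x' : ℕ → A} (h : ∀ i, π (x i) = π (x' i)) :
    x ∈ S ↔ x' ∈ S := by
  have key : ∀ i (s : Set A), MeasurableSet s → (x i ∈ s ↔ x' i ∈ s) := fun i s hs =>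
    ⟨hπ _ _ (h i) s hs, hπ _ _ (h i).symm s hs⟩
  have hle : (MeasurableSpace.pi : MeasurableSpace (ℕ → A)) ≤
      { MeasurableSet' := fun S => x ∈ S ↔ x' ∈ S
        measurableSet_empty := by simp
        measurableSet_compl := fun s hs => by simp [hs]
        measurableSet_iUnion := fun f hf => by simp [hf] } := by
    refine iSup_le fun i => ?_
    rintro _ ⟨s, hs, rfl⟩
    exact key i s hs
  exact hle _ hS

/-- The cylinder of the atoms of a word has the same measure as the cylinder of the word. -/
lemma measure_atomCyl (hπ : ∀ a b, π a = π b → ∀ s, MeasurableSet s → a ∈ s → b ∈ s)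
    {n : ℕ} (a : Fin n → A) :
    μ {x | ∀ i : Fin n, π (x i) = π (a i)} = μ (cyl a) := by
  refine le_antisymm ?_ (measure_mono fun x hx i => by rw [hx i])
  rw [← measure_toMeasurable (cyl a)]
  refine measure_mono fun x hx => ?_
  let x' : ℕ → A := fun i => if h : i < n then a ⟨i, h⟩ else x i
  have hx' : x' ∈ cyl a := fun i => by simp [x']
  refine (mem_of_atom_eq hπ (measurableSet_toMeasurable _ _) fun i => ?_).1
    (subset_toMeasurable μ _ hx')
  by_cases h : i < n
  · simpa [x', h] using (hx ⟨i, h⟩).symm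
  · simp [x', h]

lemma measure_shift_preimage_le (hstat : MeasurePreserving shift μ μ) (r : ℕ)
    (S : Set (ℕ → A)) : μ (shift^[r] ⁻¹' S) ≤ μ S :=
  (hstat.iterate r).measure_preimage_le S

/-- The upper decoupling bound, without positivity assumptions. -/
lemma measure_cyl_append_le [IsFiniteMeasure μ] (hstat : MeasurePreserving shift μ μ)
    {k : ℕ → ℝ} (hID : CondID μ k) {n m : ℕ} (a : Fin n → A) (b : Fin m → A) :
    μ (cyl (Fin.append a b)) ≤ ENNReal.ofReal (Real.exp (k n)) * (μ (cyl a) * μ (cyl b)) := by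
  rcases eq_or_ne (μ (cyl a)) 0 with ha | ha
  · have : cyl (Fin.append a b) ⊆ cyl a := fun x hx i => by
      simpa using hx (Fin.castAdd m i)
    simp [measure_mono_null this ha]
  rcases eq_or_ne (μ (cyl b)) 0 with hb | hb
  · have : cyl (Fin.append a b) ⊆ shift^[n] ⁻¹' (cyl b) := fun x hx i => by
      rw [shift_iterate]
      simpa using hx (Fin.natAdd n i)
    have h0 : μ (cyl (Fin.append a b)) ≤ 0 :=
      (measure_mono this).trans ((measure_shift_preimage_le hstat n _).trans hb.le)
    exact h0.trans zero_le
  have h := (hID.2.2 n m a b (pos_iff_ne_zero.2 ha) (pos_iff_ne_zero.2 hb)).1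
  unfold wp at h
  rw [← ENNReal.ofReal_toReal (measure_ne_top μ (cyl (Fin.append a b))),
    ← ENNReal.ofReal_toReal (measure_ne_top μ (cyl a)),
    ← ENNReal.ofReal_toReal (measure_ne_top μ (cyl b)),
    ← ENNReal.ofReal_mul ENNReal.toReal_nonneg, ← ENNReal.ofReal_mul (Real.exp_nonneg _)]
  exact ENNReal.ofReal_le_ofReal h

/-- Decoupling of a word from an event depending on finitely many later letters. -/
lemma measure_atomCyl_inter_shift_le [Finite A] [IsFiniteMeasure μ]
    (hstat : MeasurePreserving shift μ μ) {k : ℕ → ℝ} (hID : CondID μ k)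
    (hidem : ∀ a, π (π a) = π a) (hmeas : ∀ b, MeasurableSet (π ⁻¹' {b}))
    (hπ : ∀ a b, π a = π b → ∀ s, MeasurableSet s → a ∈ s → b ∈ s)
    {n m : ℕ} (a : Fin n → A) (s : Set (Fin m → A)) :
    μ ({x | ∀ i : Fin n, π (x i) = π (a i)} ∩
        shift^[n] ⁻¹' ((fun x (i : Fin m) => π (x i)) ⁻¹' s)) ≤
      ENNReal.ofReal (Real.exp (k n)) *
        (μ (cyl a) * μ ((fun x (i : Fin m) => π (x i)) ⁻¹' s)) := by
  cases nonempty_fintype A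
  set f : (ℕ → A) → Fin m → A := fun x i => π (x i) with hf
  have hfm : ∀ b, MeasurableSet (f ⁻¹' {b}) := fun b => by
    have : f ⁻¹' {b} = ⋂ i : Fin m, (fun x : ℕ → A => x i) ⁻¹' (π ⁻¹' {b i}) := by
      ext x
      simp [hf, funext_iff]
    rw [this]
    exact MeasurableSet.iInter fun i => measurable_pi_apply _ (hmeas _)
  have hs : f ⁻¹' s = f ⁻¹' (s.toFinset : Set (Fin m → A)) := by simp
  have hsum : ∑ b ∈ s.toFinset, μ (f ⁻¹' {b}) = μ (f ⁻¹' s) := by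
    rw [hs]
    exact sum_measure_preimage_singleton _ fun b _ => hfm b
  have hcover : {x | ∀ i : Fin n, π (x i) = π (a i)} ∩ shift^[n] ⁻¹' (f ⁻¹' s) ⊆
      ⋃ b ∈ s.toFinset, {x | ∀ i : Fin n, π (x i) = π (a i)} ∩ shift^[n] ⁻¹' (f ⁻¹' {b}) := by
    rintro x ⟨hx, hxs⟩
    simp only [Set.mem_iUnion]
    exact ⟨f (shift^[n] x), by simpa using hxs, hx, rfl⟩
  refine (measure_mono hcover).trans ((measure_biUnion_finset_le _ _).trans ?_)
  rw [← hsum, Finset.mul_sum, Finset.mul_sum]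
  refine Finset.sum_le_sum fun b _ => ?_
  by_cases hb : ∀ i, π (b i) = b i
  · have h1 : f ⁻¹' {b} = {x | ∀ i : Fin m, π (x i) = π (b i)} := by
      ext x
      simp [hf, funext_iff, hb]
    rw [h1, measure_atomCyl hπ]
    refine le_trans ?_ (measure_cyl_append_le hstat hID a b)
    rw [← measure_atomCyl hπ (Fin.append a b)]
    refine measure_mono fun x hx i => ?_
    induction i using Fin.addCases with
    | left i => simpa using hx.1 i
    | right i =>
      have := hx.2 i
      rw [shift_iterate] at this
      simpa using this
  · have : f ⁻¹' {b} = ∅ := by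
      ext x
      simp only [Set.mem_preimage, Set.mem_singleton_iff, Set.mem_empty_iff_false, iff_false]
      rintro rfl
      exact hb fun i => hidem _
    simp [this]

/-- Probability that prescribed words occur at prescribed distinct cells of the grid `ℓ ℕ`. -/
lemma measure_grid_atom_le [Finite A] [IsProbabilityMeasure μ]
    (hstat : MeasurePreserving shift μ μ) {k : ℕ → ℝ} (hID : CondID μ k)
    (hidem : ∀ a, π (π a) = π a) (hmeas : ∀ b, MeasurableSet (π ⁻¹' {b}))
    (hπ : ∀ a b, π a = π b → ∀ s, MeasurableSet s → a ∈ s → b ∈ s)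
    {ι : Type*} {ℓ : ℕ} {q : ℝ≥0∞} (w : ι → Fin ℓ → A) (n : ℕ) (J : Finset ι) (g : ι → ℕ)
    (hg : Set.InjOn g J) (hn : ∀ j ∈ J, g j < n)
    (hq : ∀ j ∈ J, ENNReal.ofReal (Real.exp (k ℓ)) * μ (cyl (w j)) ≤ q) :
    μ {x | ∀ j ∈ J, ∀ t : Fin ℓ, π (x (ℓ * g j + t)) = π (w j t)} ≤ q ^ J.card := by
  induction n generalizing J g with
  | zero =>
    have : J = ∅ := Finset.eq_empty_of_forall_notMem fun j hj => absurd (hn j hj) (by omega)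
    subst this
    simp
  | succ n ih =>
    by_cases h0 : ∃ j ∈ J, g j = 0
    · obtain ⟨j₀, hj₀, hgj₀⟩ := h0
      have hpos : ∀ j ∈ J.erase j₀, g j = (g j - 1) + 1 := fun j hj => by
        have : g j ≠ 0 := fun h =>
          (Finset.ne_of_mem_erase hj) (hg (Finset.mem_of_mem_erase hj) hj₀ (h.trans hgj₀.symm))
        omega
      have hrest := ih (J.erase j₀) (fun j => g j - 1)
        (fun i hi j hj hij => hg (Finset.mem_of_mem_erase hi) (Finset.mem_of_mem_erase hj) (by
          have h1 := hpos i hi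
          have h2 := hpos j hj
          simp only at hij
          omega))
        (fun j hj => by
          have h1 := hpos j hj
          have h2 := hn j (Finset.mem_of_mem_erase hj)
          omega)
        (fun j hj => hq j (Finset.mem_of_mem_erase hj))
      set S : Set (ℕ → A) :=
        {x | ∀ j ∈ J.erase j₀, ∀ t : Fin ℓ, π (x (ℓ * (g j - 1) + t)) = π (w j t)} with hS
      have hlt : ∀ j ∈ J.erase j₀, ∀ t : Fin ℓ, ℓ * (g j - 1) + t < ℓ * n := fun j hj t => by
        have h1 := hpos j hj
        have h2 := hn j (Finset.mem_of_mem_erase hj)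
        calc ℓ * (g j - 1) + t < ℓ * (g j - 1) + ℓ := by omega
          _ = ℓ * g j := by conv_rhs => rw [h1, mul_add, mul_one]
          _ ≤ ℓ * n := Nat.mul_le_mul_left _ (by omega)
      have hSf : S = (fun x (i : Fin (ℓ * n)) => π (x i)) ⁻¹'
          {b | ∀ j (hj : j ∈ J.erase j₀), ∀ t : Fin ℓ,
            b ⟨ℓ * (g j - 1) + t, hlt j hj t⟩ = π (w j t)} := rfl
      have hsub : {x : ℕ → A | ∀ j ∈ J, ∀ t : Fin ℓ, π (x (ℓ * g j + t)) = π (w j t)} ⊆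
          {x | ∀ i : Fin ℓ, π (x i) = π (w j₀ i)} ∩ shift^[ℓ] ⁻¹' S := by
        intro x hx
        refine ⟨fun i => by simpa [hgj₀] using hx j₀ hj₀ i, fun j hj t => ?_⟩
        rw [shift_iterate, ← hx j (Finset.mem_of_mem_erase hj) t]
        conv_rhs => rw [hpos j hj]
        congr 2
        ring
      refine (measure_mono hsub).trans ?_
      have hdec := measure_atomCyl_inter_shift_le hstat hID hidem hmeas hπ (w j₀)
        {b : Fin (ℓ * n) → A | ∀ j (hj : j ∈ J.erase j₀), ∀ t : Fin ℓ,
            b ⟨ℓ * (g j - 1) + t, hlt j hj t⟩ = π (w j t)}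
      rw [← hSf, ← mul_assoc] at hdec
      refine hdec.trans ((mul_le_mul' (hq j₀ hj₀) hrest).trans ?_)
      rw [← pow_succ', Finset.card_erase_add_one hj₀]
    · push Not at h0
      have hpos : ∀ j ∈ J, g j = (g j - 1) + 1 := fun j hj => by
        have := h0 j hj
        omega
      have hrest := ih J (fun j => g j - 1)
        (fun i hi j hj hij => hg hi hj (by
          have h1 := hpos i hi
          have h2 := hpos j hj
          simp only at hij
          omega))
        (fun j hj => by
          have h1 := hpos j hj
          have h2 := hn j hj
          omega)
        hq
      refine le_trans (measure_mono ?_) ((measure_shift_preimage_le hstat ℓ _).trans hrest)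
      intro x hx j hj t
      rw [shift_iterate, ← hx j hj t]
      conv_rhs => rw [hpos j hj]
      congr 2
      ring

end Decoupling

/-- Probability that prescribed words of length `ℓ` occur at prescribed distinct cells of the
translated grid `ρ + ℓ ℕ`. -/
lemma measure_grid_match_le {A : Type*} [Finite A] [MeasurableSpace A] {μ : Measure (ℕ → A)}
    [IsProbabilityMeasure μ] (hstat : MeasurePreserving shift μ μ) {k : ℕ → ℝ}
    (hID : CondID μ k) {ι : Type*} {ℓ : ℕ} {q : ℝ≥0∞} (w : ι → Fin ℓ → A) (ρ : ℕ)
    (J : Finset ι) (g : ι → ℕ) (hg : Set.InjOn g J)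
    (hq : ∀ j ∈ J, ENNReal.ofReal (Real.exp (k ℓ)) * μ (cyl (w j)) ≤ q) :
    μ {x | ∀ j ∈ J, matchAt x (w j) (ρ + ℓ * g j)} ≤ q ^ J.card := by
  obtain ⟨π, hidem, hmeas, hπ⟩ := exists_atom_section A
  refine le_trans (measure_mono ?_) ((measure_shift_preimage_le hstat ρ _).trans
    (measure_grid_atom_le hstat hID hidem hmeas hπ w (J.sup g + 1) J g hg
      (fun j hj => Nat.lt_succ_of_le (Finset.le_sup hj)) hq))
  intro x hx j hj t
  rw [shift_iterate, ← hx j hj t, add_assoc]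

/-- Union bound for the event that many of `d` distinct words of small probability occur
in `x_1^N`. -/
lemma measure_many_appear_le {A : Type*} [Finite A] [MeasurableSpace A] {μ : Measure (ℕ → A)}
    [IsProbabilityMeasure μ] (hstat : MeasurePreserving shift μ μ) {k : ℕ → ℝ}
    (hID : CondID μ k) {N d L : ℕ} {θ b : ℝ} {y : ℕ → A} {l p : ℕ → ℕ}
    (hl : ∀ j < d, 1 ≤ l j ∧ l j ≤ L) (hθ : ∀ j < d, wp μ (seg y (p j) (l j)) ≤ θ)
    (hdist : ∀ i j, i < d → j < d → l i = l j → (∀ t < l i, y (p i + t) = y (p j + t)) → i = j) :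
    μ {x | (L : ℝ) ^ 2 * b <
        (Set.ncard {j | j < d ∧ appears N x (seg y (p j) (l j))} : ℝ)} ≤
      L ^ 2 * (d.choose ⌈b⌉₊ *
        (N ^ ⌈b⌉₊ * (ENNReal.ofReal (Real.exp (k L)) * ENNReal.ofReal θ) ^ ⌈b⌉₊)) := by
  set m := ⌈b⌉₊
  set q := ENNReal.ofReal (Real.exp (k L)) * ENNReal.ofReal θ
  let E : ℕ × ℕ → (J : Finset ℕ) → (J → Fin N) → Set (ℕ → A) := fun a J g =>
    {x | (Function.Injective g ∧ (∀ j ∈ J, j < d ∧ l j = a.1) ∧ a.1 ≤ L) ∧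
      ∀ j ∈ (Finset.univ : Finset J), matchAt x (seg y (p j) a.1) (a.2 + a.1 * (g j : ℕ))}
  have hE : ∀ a J g, μ (E a J g) ≤ q ^ J.card := by
    intro a J g
    by_cases h : Function.Injective g ∧ (∀ j ∈ J, j < d ∧ l j = a.1) ∧ a.1 ≤ L
    · rw [← Finset.card_attach (s := J), ← Finset.univ_eq_attach]
      refine le_trans (measure_mono fun x hx => hx.2)
        (measure_grid_match_le hstat hID (fun j : J => seg y (p j) a.1) a.2 Finset.univ
          (fun j => (g j : ℕ)) (fun i _ j _ hij => h.1 (Fin.ext hij)) fun j _ => ?_)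
      refine mul_le_mul' (ENNReal.ofReal_le_ofReal (Real.exp_le_exp.2 (hID.1 h.2.2))) ?_
      have h1 := h.2.1 j j.2
      have h2 := hθ j h1.1
      rw [h1.2] at h2
      exact (ENNReal.le_ofReal_iff_toReal_le (measure_ne_top _ _)
        (ENNReal.toReal_nonneg.trans h2)).2 h2
    · simp [E, h]
  have hsub : {x | (L : ℝ) ^ 2 * b <
        (Set.ncard {j | j < d ∧ appears N x (seg y (p j) (l j))} : ℝ)} ⊆
      ⋃ a ∈ Finset.Icc 1 L ×ˢ Finset.range L, ⋃ J ∈ Finset.powersetCard m (Finset.range d),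
        ⋃ g ∈ (Finset.univ : Finset (J → Fin N)), E a J g := by
    intro x hx
    set M : Finset ℕ := (Finset.range d).filter fun j => appears N x (seg y (p j) (l j)) with hM
    have hMset : {j | j < d ∧ appears N x (seg y (p j) (l j))} = (M : Set ℕ) := by
      ext j
      simp [hM]
    rw [Set.mem_ofPred_eq, hMset, Set.ncard_coe_finset] at hx
    have hmem : ∀ j ∈ M, j < d ∧ ∃ r, r + l j ≤ N ∧ matchAt x (seg y (p j) (l j)) r :=
      fun j hj => by
      rwa [hM, Finset.mem_filter, Finset.mem_range] at hj
    choose! r hr using fun j hj => (hmem j hj).2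
    obtain ⟨a, ha, hcard⟩ := Finset.exists_lt_card_fiber_of_nsmul_lt_card_of_maps_to
      (s := M) (t := Finset.Icc 1 L ×ˢ Finset.range L) (f := fun j => (l j, r j % l j)) (b := b)
      (fun j hj => by
        have := hl j (hmem j hj).1
        have h2 := Nat.mod_lt (r j) this.1
        simp only [Finset.mem_product, Finset.mem_Icc, Finset.mem_range]
        omega)
      (by
        rw [nsmul_eq_mul]
        simpa [sq] using hx)
    obtain ⟨J, hJ, hJm⟩ := Finset.exists_subset_card_eq (Nat.ceil_le.2 hcard.le)
    have hJ' : ∀ j ∈ J, j ∈ M ∧ l j = a.1 ∧ r j % l j = a.2 := fun j hj => by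
      have := hJ hj
      simp only [Finset.mem_filter, Prod.ext_iff] at this
      exact this
    have hrj : ∀ j ∈ J, a.2 + a.1 * (r j / a.1) = r j := fun j hj => by
      obtain ⟨-, h1, h2⟩ := hJ' j hj
      rw [← h1, ← h2, Nat.mod_add_div]
    have hlt : ∀ j ∈ J, r j / a.1 < N := fun j hj => by
      obtain ⟨h0, h1, h2⟩ := hJ' j hj
      have h3 := hl j (hmem j h0).1
      have h4 := (hr j h0).1
      have h5 := Nat.div_le_self (r j) a.1
      omega
    simp only [Set.mem_iUnion]
    refine ⟨a, ha, J, ?_, fun j => ⟨r j / a.1, hlt j j.2⟩, Finset.mem_univ _, ⟨?_, ?_, ?_⟩, ?_⟩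
    · rw [Finset.mem_powersetCard]
      exact ⟨fun j hj => Finset.mem_range.2 (hmem j (hJ' j hj).1).1, hJm⟩
    · intro i j hij
      obtain ⟨hi0, hi1, -⟩ := hJ' i i.2
      obtain ⟨hj0, hj1, -⟩ := hJ' j j.2
      have hrr : r i = r j := by
        rw [← hrj i i.2, ← hrj j j.2, Fin.mk.inj hij]
      refine Subtype.ext (hdist i j (hmem i hi0).1 (hmem j hj0).1 (hi1.trans hj1.symm)
        fun t ht => ?_)
      have h1 := (hr i hi0).2 ⟨t, ht⟩
      have h2 := (hr j hj0).2 ⟨t, by omega⟩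
      simp only [seg] at h1 h2
      rw [← h1, ← h2, hrr]
    · exact fun j hj => ⟨(hmem j (hJ' j hj).1).1, (hJ' j hj).2.1⟩
    · simp only [Finset.mem_product, Finset.mem_Icc] at ha
      exact ha.1.2
    · intro j _ t
      obtain ⟨h0, h1, -⟩ := hJ' j j.2
      have := (hr j h0).2 ⟨t, by omega⟩
      simp only [hrj j j.2]
      exact this
  refine (measure_mono hsub).trans ?_
  calc _ ≤ ∑ a ∈ Finset.Icc 1 L ×ˢ Finset.range L, ∑ J ∈ Finset.powersetCard m (Finset.range d),
        ∑ g ∈ (Finset.univ : Finset (J → Fin N)), μ (E a J g) := by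
        refine (measure_biUnion_finset_le _ _).trans (Finset.sum_le_sum fun a _ => ?_)
        refine (measure_biUnion_finset_le _ _).trans (Finset.sum_le_sum fun J _ => ?_)
        exact measure_biUnion_finset_le _ _
    _ ≤ ∑ a ∈ Finset.Icc 1 L ×ˢ Finset.range L, ∑ J ∈ Finset.powersetCard m (Finset.range d),
        (N ^ m * q ^ m) := by
        refine Finset.sum_le_sum fun a _ => Finset.sum_le_sum fun J hJ => ?_
        refine (Finset.sum_le_sum fun g _ => hE a J g).trans ?_
        simp [(Finset.mem_powersetCard.1 hJ).2]
    _ = _ := by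
        simp [sq, mul_assoc]

section Parsing

variable {A : Type*} [MeasurableSpace A] {μ : Measure (ℕ → A)} {θ : ℝ} {e q : ℕ} {y : ℕ → A}

lemma blkLen_spec {j : ℕ} (hj : j < dCount μ θ e y q) :
    1 ≤ blkLen μ θ e y (blkPos μ θ e y q j) ∧
      blkPos μ θ e y q j + blkLen μ θ e y (blkPos μ θ e y q j) ≤ e ∧
      wp μ (seg y (blkPos μ θ e y q j) (blkLen μ θ e y (blkPos μ θ e y q j))) ≤ θ := by
  have h0 : blkLen μ θ e y (blkPos μ θ e y q j) ≠ 0 :=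
    Nat.notMem_of_lt_sInf (s := {i | blkLen μ θ e y (blkPos μ θ e y q i) = 0}) hj
  have hne := Nat.nonempty_of_sInf_eq_succ (Nat.succ_pred_eq_of_ne_zero h0).symm
  exact Nat.sInf_mem hne

lemma add_le_blkPos {j : ℕ} (hj : j ≤ dCount μ θ e y q) : q + j ≤ blkPos μ θ e y q j := by
  induction j with
  | zero => simp [blkPos]
  | succ j ih =>
    have h1 := ih (by omega)
    have h2 := (blkLen_spec (Nat.lt_of_succ_le hj)).1
    rw [blkPos]
    omega

lemma dCount_le {B : ℕ} (h : e ≤ q + B) : dCount μ θ e y q ≤ B := by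
  rcases Nat.eq_zero_or_pos (dCount μ θ e y q) with h0 | h0
  · omega
  obtain ⟨d, hd⟩ := Nat.exists_eq_succ_of_ne_zero h0.ne'
  have h1 := blkLen_spec (μ := μ) (θ := θ) (e := e) (y := y) (q := q) (j := d) (by omega)
  have h2 := add_le_blkPos (μ := μ) (θ := θ) (e := e) (y := y) (q := q) (j := d) (by omega)
  omega

lemma measure_cyl_seg_pos (hstat : MeasurePreserving shift μ μ) (hy : y ∈ suppSet μ)
    (p ℓ : ℕ) : 0 < μ (cyl (seg y p ℓ)) := by
  refine (hy (p + ℓ)).trans_le (le_trans (measure_mono ?_) (measure_shift_preimage_le hstat p _))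
  intro x hx i
  rw [shift_iterate]
  simpa [seg] using hx (Fin.natAdd p i)

/-- Parsed words have length at most `L` as soon as all words of length `L` have small
probability. -/
lemma blkLen_le (hstat : MeasurePreserving shift μ μ) (hy : y ∈ suppSet μ) {L : ℕ} (hL : 1 ≤ L)
    (hθ : ∀ a : Fin L → A, 0 < μ (cyl a) → wp μ a ≤ θ) {j : ℕ} (hj : j < dCount μ θ e y q) :
    blkLen μ θ e y (blkPos μ θ e y q j) ≤ L := by
  by_contra! h
  have h1 := (blkLen_spec hj).2.1
  have h2 : blkLen μ θ e y (blkPos μ θ e y q j) ≤ L :=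
    Nat.sInf_le ⟨hL, by omega, hθ _ (measure_cyl_seg_pos hstat hy _ _)⟩
  omega

end Parsing

/-- Chernoff-type bound on binomial coefficients. -/
lemma choose_le_exp_mul {d m : ℕ} {t : ℝ} (ht : 0 < t) :
    (d.choose m : ℝ) ≤ Real.exp (t * d - m * Real.log t) := by
  have h1 : (d.choose m : ℝ) * t ^ m ≤ Real.exp (t * d) := by
    rcases lt_or_ge d m with h | h
    · simp [Nat.choose_eq_zero_of_lt h, Real.exp_nonneg]
    calc (d.choose m : ℝ) * t ^ m
        ≤ ∑ i ∈ Finset.range (d + 1), t ^ i * 1 ^ (d - i) * d.choose i := by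
          refine le_trans (le_of_eq ?_) (Finset.single_le_sum
            (f := fun i => t ^ i * 1 ^ (d - i) * (d.choose i : ℝ)) (fun i _ => by positivity)
            (Finset.mem_range.2 (Nat.lt_succ_of_le h)))
          simp [mul_comm]
      _ = (t + 1) ^ d := (add_pow t 1 d).symm
      _ ≤ Real.exp t ^ d := pow_le_pow_left₀ (by positivity) (Real.add_one_le_exp t) d
      _ = Real.exp (t * d) := by rw [← Real.exp_nat_mul, mul_comm]
  rw [Real.exp_sub, Real.exp_nat_mul, Real.exp_log ht]
  exact (le_div_iff₀ (by positivity)).2 h1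

/-- With logarithmically short words, the union bound is stretched-exponentially small. -/
lemma choose_mul_pow_le {N d m L : ℕ} {ε α γp γm k : ℝ} (hε : 0 < ε) (hγp : γp < 0)
    (hγm : γm < 0) (hΛ : 1 ≤ Real.log N) (hΛ' : 8 / (3 * -γm * γp ^ 2 * ε ^ 2) ≤ Real.log N)
    (hlog : 3 * Real.log (Real.log N) ≤ ε / 8 * Real.log N) (hk : k ≤ ε / 4 * Real.log N)
    (hd : (d : ℝ) ≤ (N : ℝ) ^ α) (hL : 1 ≤ L) (hL' : (L : ℝ) ≤ ellPlus N γp)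
    (hm : ε * dPlus N α γm / (L : ℝ) ^ 2 ≤ m) :
    (d.choose m : ℝ) * ((N : ℝ) ^ m * (Real.exp k * (N : ℝ) ^ (-1 - ε)) ^ m) ≤
      Real.exp (γp * ε ^ 2 * dPlus N α γm / (8 * ellPlus N γp)) := by
  have hN : (0 : ℝ) < N := by
    rcases Nat.eq_zero_or_pos N with h | h
    · norm_num [h] at hΛ
    · exact_mod_cast h
  set Λ := Real.log N with hΛdef
  have hΛ0 : 0 < Λ := by linarith
  obtain ⟨c, hc, rfl⟩ : ∃ c, 0 < c ∧ γp = -c := ⟨-γp, by linarith, by ring⟩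
  obtain ⟨g, hg, rfl⟩ : ∃ g, 0 < g ∧ γm = -g := ⟨-γm, by linarith, by ring⟩
  set D := dPlus N α (-g) with hD
  have hNα : (N : ℝ) ^ α = D * Λ / (4 * g) := by
    rw [hD, dPlus, ellMinus, ← hΛdef]
    field_simp
    ring
  have hD0 : 0 ≤ D := by
    have : 0 ≤ D * Λ / (4 * g) := hNα ▸ Real.rpow_nonneg hN.le α
    by_contra! h
    have : D * Λ / (4 * g) < 0 := div_neg_of_neg_of_pos (mul_neg_of_neg_of_pos h hΛ0) (by linarith)
    linarith
  have hell : ellPlus N (-c) = 2 * Λ / c := by rw [ellPlus, neg_neg]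
  rw [hell] at hL' ⊢
  have hL0 : (0 : ℝ) < L := by exact_mod_cast hL
  have hm' : c ^ 2 * ε * D / (4 * Λ ^ 2) ≤ m := by
    refine le_trans ?_ hm
    calc c ^ 2 * ε * D / (4 * Λ ^ 2) = ε * D / (2 * Λ / c) ^ 2 := by field_simp; ring
      _ ≤ _ := by gcongr
  have hpow : (N : ℝ) ^ m * (Real.exp k * (N : ℝ) ^ (-1 - ε)) ^ m =
      Real.exp (m * (k - ε * Λ)) := by
    rw [← mul_pow, Real.exp_nat_mul, Real.rpow_def_of_pos hN, ← Real.exp_add, ← hΛdef]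
    congr 1
    nth_rewrite 1 [← Real.exp_log hN]
    rw [← Real.exp_add, ← hΛdef]
    congr 1
    ring
  have ht : 0 < (Λ ^ 3)⁻¹ := by positivity
  rw [hpow]
  refine (mul_le_mul_of_nonneg_right (choose_le_exp_mul ht) (Real.exp_nonneg _)).trans ?_
  rw [← Real.exp_add, Real.exp_le_exp, Real.log_inv, Real.log_pow]
  have htd : (Λ ^ 3)⁻¹ * d ≤ 3 * c ^ 2 * ε ^ 2 * D / (32 * Λ) := by
    calc (Λ ^ 3)⁻¹ * d ≤ (Λ ^ 3)⁻¹ * (D * Λ / (4 * g)) := by rw [← hNα]; gcongr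
      _ = D / (4 * g * Λ) * (1 / Λ) := by field_simp
      _ ≤ D / (4 * g * Λ) * (3 * g * c ^ 2 * ε ^ 2 / 8) := by
        refine mul_le_mul_of_nonneg_left ?_ (by positivity)
        rw [neg_neg, neg_sq, div_le_iff₀ (by positivity)] at hΛ'
        rw [div_le_iff₀ hΛ0]
        nlinarith
      _ = _ := by field_simp; ring
  have hmain : (m : ℝ) * (3 * Real.log Λ + k - ε * Λ) ≤ -(5 / 32 * c ^ 2 * ε ^ 2 * D / Λ) := by
    calc (m : ℝ) * (3 * Real.log Λ + k - ε * Λ) ≤ m * (-(5 / 8 * ε * Λ)) := by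
          refine mul_le_mul_of_nonneg_left ?_ (Nat.cast_nonneg m)
          linarith
      _ ≤ c ^ 2 * ε * D / (4 * Λ ^ 2) * (-(5 / 8 * ε * Λ)) :=
          mul_le_mul_of_nonpos_right hm' (by have := mul_pos hε hΛ0; linarith)
      _ = _ := by field_simp; ring
  have hgoal : -c * ε ^ 2 * D / (8 * (2 * Λ / c)) =
      3 * c ^ 2 * ε ^ 2 * D / (32 * Λ) - 5 / 32 * c ^ 2 * ε ^ 2 * D / Λ := by
    field_simp
    ring
  rw [hgoal]
  push_cast
  linarith

/-- **Proposition 3.9.** In a good block, with high probability only a small fraction of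
the words appear in `x_1^N`. -/
theorem good_block_few_matches {A : Type*} [Fintype A] [MeasurableSpace A]
    (μP : Measure (ℕ → A)) [IsProbabilityMeasure μP]
    (hPstat : MeasurePreserving shift μP μP)
    (kP : ℕ → ℝ) (γp γm : ℝ)
    (hPID : CondID μP kP) (hPFE : CondFE μP γp) (hPSE : CondSE μP γm)
    (ε α : ℝ) (hε : 0 < ε ∧ ε < 1 / 2) (hα : 0 < α ∧ α < γp / (8 * γm))
    (y : ℕ → A) (hy : y ∈ suppSet μP) :
    ∀ᶠ N : ℕ in atTop, ∀ s : ℕ,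
      GoodBlock μP ((N : ℝ) ^ (-1 - ε)) (blockEnd N α s) y (blockStart N α s) →
      (μP {x | ε * dPlus N α γm < (Set.ncard {j |
          j < dCount μP ((N : ℝ) ^ (-1 - ε)) (blockEnd N α s) y (blockStart N α s) ∧
          appears N x (seg y
            (blkPos μP ((N : ℝ) ^ (-1 - ε)) (blockEnd N α s) y (blockStart N α s) j)
            (blkLen μP ((N : ℝ) ^ (-1 - ε)) (blockEnd N α s) y
              (blkPos μP ((N : ℝ) ^ (-1 - ε)) (blockEnd N α s) y (blockStart N α s) j)))} :
            ℝ)}).toReal ≤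
        ellPlus N γp ^ 2 * Real.exp (γp * ε ^ 2 * dPlus N α γm / (8 * ellPlus N γp)) := by
  obtain ⟨hε0, hε1⟩ := hε
  obtain ⟨hγp, hFE⟩ := hPFE
  have hγm := hPSE.1
  have hlogN : Tendsto (fun N : ℕ => Real.log N) atTop atTop :=
    Real.tendsto_log_atTop.comp tendsto_natCast_atTop_atTop
  have hell : Tendsto (fun N : ℕ => ellPlus N γp) atTop atTop :=
    (hlogN.const_mul_atTop two_pos).atTop_div_const (neg_pos.2 hγp)
  have hfloor : Tendsto (fun N : ℕ => ⌊ellPlus N γp⌋₊) atTop atTop :=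
    tendsto_nat_floor_atTop.comp hell
  have hk := hfloor.eventually (hPID.2.1.bound (c := ε * -γp / 8)
    (div_pos (mul_pos hε0 (neg_pos.2 hγp)) (by norm_num)))
  have hloglog := hlogN.eventually
    (Real.isLittleO_log_id_atTop.bound (c := ε / 24) (by positivity))
  filter_upwards [hlogN.eventually_ge_atTop 1,
    hlogN.eventually_ge_atTop (8 / (3 * -γm * γp ^ 2 * ε ^ 2)),
    hlogN.eventually_ge_atTop (2 * -γp), hk, hloglog, hfloor.eventually_ge_atTop 1,
    hfloor.eventually hFE] with N hN1 hN2 hN3 hkN hlogN' hL hFEN s hgood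
  set L := ⌊ellPlus N γp⌋₊ with hLdef
  set θ : ℝ := (N : ℝ) ^ (-1 - ε) with hθdef
  set e := blockEnd N α s
  set q := blockStart N α s
  have hΛ0 : 0 < Real.log N := by linarith
  have hN0 : (0 : ℝ) < N := by
    rcases Nat.eq_zero_or_pos N with h | h
    · norm_num [h] at hN1
    · exact_mod_cast h
  have hell0 : 0 ≤ ellPlus N γp := div_nonneg (by linarith) (by linarith)
  have hLle : (L : ℝ) ≤ ellPlus N γp := Nat.floor_le hell0
  have hellmul : ellPlus N γp * -γp = 2 * Real.log N := div_mul_cancel₀ _ (neg_pos.2 hγp).ne'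
  have hθ : ∀ a : Fin L → A, 0 < μP (cyl a) → wp μP a ≤ θ := fun a ha => by
    refine (hFEN a ha).trans ?_
    rw [hθdef, Real.rpow_def_of_pos hN0, Real.exp_le_exp]
    have h1 : ellPlus N γp < L + 1 := Nat.lt_floor_add_one _
    nlinarith
  have hkL : kP L ≤ ε / 4 * Real.log N := by
    have h1 : kP L ≤ ε * -γp / 8 * L := by
      simpa using (le_abs_self _).trans hkN
    have h2 : ε * -γp / 8 * L ≤ ε * -γp / 8 * ellPlus N γp :=
      mul_le_mul_of_nonneg_left hLle (by nlinarith)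
    nlinarith
  have hloglogN : 3 * Real.log (Real.log N) ≤ ε / 8 * Real.log N := by
    have h1 := (le_abs_self _).trans hlogN'
    rw [Real.norm_eq_abs, id, abs_of_pos hΛ0] at h1
    linarith
  have hd : (dCount μP θ e y q : ℝ) ≤ (N : ℝ) ^ α := by
    refine le_trans ?_ (Nat.floor_le (Real.rpow_nonneg hN0.le α))
    exact_mod_cast dCount_le (min_le_left _ _ |>.trans (by rw [add_mul, one_mul]; rfl))
  have hL0 : (0 : ℝ) < L := by exact_mod_cast hL
  have hmeas := measure_many_appear_le hPstat hPID (N := N) (L := L) (θ := θ)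
    (b := ε * dPlus N α γm / (L : ℝ) ^ 2)
    (d := dCount μP θ e y q) (l := fun j => blkLen μP θ e y (blkPos μP θ e y q j))
    (p := fun j => blkPos μP θ e y q j)
    (fun j hj => ⟨(blkLen_spec hj).1, blkLen_le hPstat hy hL hθ hj⟩)
    (fun j hj => (blkLen_spec hj).2.2) hgood
  rw [mul_div_cancel₀ _ (by positivity)] at hmeas
  refine (ENNReal.toReal_mono (by finiteness) hmeas).trans ?_
  have hθ0 : 0 ≤ θ := Real.rpow_nonneg hN0.le _
  simp only [ENNReal.toReal_mul, ENNReal.toReal_pow, ENNReal.toReal_natCast,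
    ENNReal.toReal_ofReal (Real.exp_nonneg _), ENNReal.toReal_ofReal hθ0]
  exact mul_le_mul (pow_le_pow_left₀ hL0.le hLle 2)
    (choose_mul_pow_le hε0 hγp hγm hN1 hN2 hloglogN hkL hd hL hLle (Nat.le_ceil _))
    (by positivity) (by positivity)
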